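/- Let n ≥ 1, c > 0, let g be a constant symmetric invertible (n+1)×(n+1) real matrix with inverse entries g^{μν}, let U ⊆ ℝ^{n+1} be open, and let u : U → ℝ^{n+1}, ε : U → ℝ, p : U → ℝ, and τ : U → symmetric (n+1)×(n+1) real matrices (components τ^{μν}) be smooth, with Σ_{μ,ν} g_{μν} u^μ(x) u^ν(x) = −c² and Σ_ν τ^{μν}(x) u_ν(x) = 0 for all x ∈ U, where u_ν := Σ_λ g_{νλ} u^λ. Define T^{μν} := c^{-2} ε u^μ u^ν + p P^{μν} − τ^{μν} with P^{μν} := g^{μν} + c^{-2} u^μ u^ν, and write τ:∂u := Σ_{μ,ν} τ^{μν} ∂_μ u_ν. Then Σ_μ ∂_μ T^{μν} = 0 on U for every ν if and only if both of the following hold on U: (a) Σ_μ ∂_μ(ε u^μ) + p Σ_μ ∂_μ u^μ = τ:∂u (energy equation), and (b) c^{-2} ( (ε + p) Σ_μ u^μ ∂_μ u^λ + u^λ (τ:∂u) ) = − Σ_μ P^{λμ} ∂_μ p + Σ_μ ∂_μ τ^{μλ} for every λ (relativistic Euler-Cauchy equation). -/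

import Mathlib

noncomputable section

/-- The partial derivative `∂_μ f` of a function on `ℝ^{n+1}` in the `μ`-th coordinate
direction. -/
def pder {N : ℕ} (f : (Fin N → ℝ) → ℝ) (μ : Fin N) (x : Fin N → ℝ) : ℝ :=
  fderiv ℝ f x (Pi.single μ 1)

section PartialDerivatives

variable {N : ℕ} {f h : (Fin N → ℝ) → ℝ} {μ : Fin N} {x : Fin N → ℝ}

theorem pder_add (hf : DifferentiableAt ℝ f x) (hh : DifferentiableAt ℝ h x) :
    pder (fun z => f z + h z) μ x = pder f μ x + pder h μ x := by
  simp [pder, fderiv_fun_add hf hh]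

theorem pder_sub (hf : DifferentiableAt ℝ f x) (hh : DifferentiableAt ℝ h x) :
    pder (fun z => f z - h z) μ x = pder f μ x - pder h μ x := by
  simp [pder, fderiv_fun_sub hf hh]

theorem pder_mul (hf : DifferentiableAt ℝ f x) (hh : DifferentiableAt ℝ h x) :
    pder (fun z => f z * h z) μ x = f x * pder h μ x + h x * pder f μ x := by
  simp [pder, fderiv_fun_mul hf hh]

theorem pder_const (a : ℝ) : pder (fun _ : Fin N → ℝ => a) μ x = 0 := by
  simp [pder]

theorem pder_sum {ι : Type*} {s : Finset ι} {F : ι → (Fin N → ℝ) → ℝ}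
    (hF : ∀ i ∈ s, DifferentiableAt ℝ (F i) x) :
    pder (fun z => ∑ i ∈ s, F i z) μ x = ∑ i ∈ s, pder (F i) μ x := by
  simp [pder, fderiv_fun_sum hF]

theorem pder_eq_zero_of_eqOn {U : Set (Fin N → ℝ)} (hU : IsOpen U) (hx : x ∈ U) {a : ℝ}
    (hf : ∀ z ∈ U, f z = a) : pder f μ x = 0 := by
  have : f =ᶠ[nhds x] fun _ => a := Filter.eventually_of_mem (hU.mem_nhds hx) hf
  simp [pder, this.fderiv_eq]

end PartialDerivatives

theorem sum_mul_sum_comm {ι κ : Type*} [Fintype ι] [Fintype κ] (w : ι → ℝ) (A : ι → κ → ℝ) :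
    ∑ i, w i * ∑ j, A i j = ∑ j, ∑ i, w i * A i j := by
  simp only [Finset.mul_sum]
  exact Finset.sum_comm

/-- Contracting a vector `a u E + a k A + G + a u q - F` with a covector `w` satisfying
`w u = -a⁻¹`, `w A = 0`, `w G = q` and `w F = -S` yields `S - E`; hence the vector vanishes iff
`E = S` and the vector vanishes with `E` replaced by `S`. -/
theorem forall_eq_zero_iff_of_contraction {ι : Type*} [Fintype ι] {a k E S q : ℝ}
    {w u A G F : ι → ℝ} (ha : a ≠ 0) (hwu : ∑ i, w i * u i = -a⁻¹)
    (hwA : ∑ i, w i * A i = 0) (hwG : ∑ i, w i * G i = q) (hwF : ∑ i, w i * F i = -S) :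
    (∀ i, a * u i * E + a * k * A i + G i + a * u i * q - F i = 0) ↔
      E = S ∧ ∀ i, a * (k * A i + u i * S) = -(G i + a * u i * q) + F i := by
  constructor
  · intro H
    have key : ∑ i, w i * (a * u i * E + a * k * A i + G i + a * u i * q - F i) =
        a * E * ∑ i, w i * u i + a * k * ∑ i, w i * A i + ∑ i, w i * G i
          + a * q * ∑ i, w i * u i - ∑ i, w i * F i := by
      simp only [Finset.mul_sum, ← Finset.sum_add_distrib, ← Finset.sum_sub_distrib]
      exact Finset.sum_congr rfl fun i _ => by ring
    simp only [H, mul_zero, Finset.sum_const_zero, hwu, hwA, hwG, hwF] at key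
    have hES : E = S := by
      field_simp at key
      linarith
    exact ⟨hES, fun i => by linear_combination H i - a * u i * hES⟩
  · rintro ⟨rfl, H⟩ i
    linear_combination H i

/-- For a general relativistic continuum with stress-energy-momentum
tensor `T^{μν} = c⁻² ε u^μ u^ν + p P^{μν} − τ^{μν}` (with `P^{μν} = g^{μν} + c⁻² u^μ u^ν`
and `τ` symmetric, orthogonal to `u`) in coordinates where the Lorentzian metric `g` is
constant, the conservation law `∂_μ T^{μν} = 0` is equivalent to the energy equation
together with the relativistic Euler-Cauchy equation. -/
theorem continuum_conservation_equivalence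
    (n : ℕ) (hn : 1 ≤ n) (c : ℝ) (hc : 0 < c)
    (g : Fin (n + 1) → Fin (n + 1) → ℝ) (hgsym : ∀ μ ν, g μ ν = g ν μ)
    (hgdet : IsUnit (Matrix.of g).det)
    (U : Set (Fin (n + 1) → ℝ)) (hU : IsOpen U)
    (u : (Fin (n + 1) → ℝ) → Fin (n + 1) → ℝ)
    (ε prs : (Fin (n + 1) → ℝ) → ℝ)
    (τ : (Fin (n + 1) → ℝ) → Fin (n + 1) → Fin (n + 1) → ℝ)
    (hu : ∀ μ, ContDiffOn ℝ (⊤ : ℕ∞) (fun x => u x μ) U)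
    (hε : ContDiffOn ℝ (⊤ : ℕ∞) ε U) (hprs : ContDiffOn ℝ (⊤ : ℕ∞) prs U)
    (hτ : ∀ μ ν, ContDiffOn ℝ (⊤ : ℕ∞) (fun x => τ x μ ν) U)
    (hτsym : ∀ x ∈ U, ∀ μ ν, τ x μ ν = τ x ν μ)
    (hτu : ∀ x ∈ U, ∀ μ : Fin (n + 1),
      (∑ ν, τ x μ ν * ∑ l, g ν l * u x l) = 0)
    (hnorm : ∀ x ∈ U, (∑ μ, ∑ ν, g μ ν * u x μ * u x ν) = -c ^ 2) :
    (∀ x ∈ U, ∀ ν : Fin (n + 1),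
        (∑ μ, pder (fun z => (c ^ 2)⁻¹ * ε z * u z μ * u z ν
          + prs z * ((Matrix.of g)⁻¹ μ ν + (c ^ 2)⁻¹ * u z μ * u z ν)
          - τ z μ ν) μ x) = 0)
    ↔ ((∀ x ∈ U,
          (∑ μ, pder (fun z => ε z * u z μ) μ x)
              + prs x * ∑ μ, pder (fun z => u z μ) μ x
            = ∑ μ, ∑ ν, τ x μ ν * pder (fun z => ∑ l, g ν l * u z l) μ x)
        ∧ (∀ x ∈ U, ∀ l : Fin (n + 1),
          (c ^ 2)⁻¹ * ((ε x + prs x) * (∑ μ, u x μ * pder (fun z => u z l) μ x)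
              + u x l * ∑ μ, ∑ ν, τ x μ ν * pder (fun z => ∑ l', g ν l' * u z l') μ x)
            = (-∑ μ, ((Matrix.of g)⁻¹ l μ + (c ^ 2)⁻¹ * u x l * u x μ)
                  * pder prs μ x)
              + ∑ μ, pder (fun z => τ z μ l) μ x)) := by
  have hc2 : (c ^ 2)⁻¹ ≠ 0 := by positivity
  have du : ∀ x ∈ U, ∀ μ, DifferentiableAt ℝ (fun z => u z μ) x := fun x hx μ =>
    ((hu μ).contDiffAt (hU.mem_nhds hx)).differentiableAt (by simp)
  have dε : ∀ x ∈ U, DifferentiableAt ℝ ε x := fun x hx =>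
    (hε.contDiffAt (hU.mem_nhds hx)).differentiableAt (by simp)
  have dp : ∀ x ∈ U, DifferentiableAt ℝ prs x := fun x hx =>
    (hprs.contDiffAt (hU.mem_nhds hx)).differentiableAt (by simp)
  have dτ : ∀ x ∈ U, ∀ μ ν, DifferentiableAt ℝ (fun z => τ z μ ν) x := fun x hx μ ν =>
    ((hτ μ ν).contDiffAt (hU.mem_nhds hx)).differentiableAt (by simp)
  have hginv : ∀ μ ν, (Matrix.of g)⁻¹ μ ν = (Matrix.of g)⁻¹ ν μ := by
    have hT : (Matrix.of g).transpose = Matrix.of g := by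
      ext i j
      exact hgsym j i
    intro μ ν
    conv_lhs => rw [← hT, ← Matrix.transpose_nonsing_inv]
    rfl
  rw [← forall₂_and]
  refine forall₂_congr fun x hx => ?_
  have dlow : ∀ ν, DifferentiableAt ℝ (fun z => ∑ l, g ν l * u z l) x := fun ν =>
    DifferentiableAt.fun_sum fun l _ => (du x hx l).const_mul _
  have plow : ∀ ν m, pder (fun z => ∑ l, g ν l * u z l) m x
      = ∑ l, g ν l * pder (fun z => u z l) m x := by
    intro ν m
    rw [pder_sum fun l _ => (du x hx l).const_mul _]
    refine Finset.sum_congr rfl fun l _ => ?_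
    rw [pder_mul (differentiableAt_const _) (du x hx l), pder_const]
    ring
  have hwdu : ∀ m, ∑ ν, (∑ l, g ν l * u x l) * pder (fun z => u z ν) m x = 0 := by
    intro m
    have h0 : pder (fun z => ∑ ν, (∑ l, g ν l * u z l) * u z ν) m x = 0 := by
      refine pder_eq_zero_of_eqOn hU hx (a := -c ^ 2) fun z hz => ?_
      rw [← hnorm z hz]
      refine Finset.sum_congr rfl fun ν _ => ?_
      rw [Finset.sum_mul]
      exact Finset.sum_congr rfl fun l _ => by ring
    rw [pder_sum fun ν _ => (dlow ν).fun_mul (du x hx ν)] at h0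
    simp only [pder_mul (dlow _) (du x hx _), plow, Finset.sum_add_distrib] at h0
    have hswap : ∑ ν, u x ν * ∑ l, g ν l * pder (fun z => u z l) m x
        = ∑ ν, (∑ l, g ν l * u x l) * pder (fun z => u z ν) m x := by
      simp only [Finset.mul_sum, Finset.sum_mul]
      rw [Finset.sum_comm]
      refine Finset.sum_congr rfl fun ν _ => Finset.sum_congr rfl fun l _ => ?_
      rw [hgsym l ν]
      ring
    linarith
  have hwτ : ∀ m μ, ∑ ν, (∑ l, g ν l * u x l) * pder (fun z => τ z μ ν) m x
      = -∑ ν, τ x μ ν * pder (fun z => ∑ l, g ν l * u z l) m x := by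
    intro m μ
    have h0 := pder_eq_zero_of_eqOn (μ := m) hU hx fun z hz => hτu z hz μ
    rw [pder_sum fun ν _ => (dτ x hx μ ν).fun_mul (dlow ν)] at h0
    simp only [pder_mul (dτ x hx μ _) (dlow _), Finset.sum_add_distrib] at h0
    linarith
  have hdiv : ∀ ν, (∑ μ, pder (fun z => (c ^ 2)⁻¹ * ε z * u z μ * u z ν
          + prs z * ((Matrix.of g)⁻¹ μ ν + (c ^ 2)⁻¹ * u z μ * u z ν) - τ z μ ν) μ x)
      = (c ^ 2)⁻¹ * u x ν * ((∑ μ, pder (fun z => ε z * u z μ) μ x)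
            + prs x * ∑ μ, pder (fun z => u z μ) μ x)
        + (c ^ 2)⁻¹ * (ε x + prs x) * (∑ μ, u x μ * pder (fun z => u z ν) μ x)
        + (∑ μ, (Matrix.of g)⁻¹ ν μ * pder prs μ x)
        + (c ^ 2)⁻¹ * u x ν * (∑ μ, u x μ * pder prs μ x)
        - ∑ μ, pder (fun z => τ z μ ν) μ x := by
    intro ν
    simp only [Finset.mul_sum, ← Finset.sum_add_distrib, ← Finset.sum_sub_distrib]
    refine Finset.sum_congr rfl fun μ _ => ?_
    have d1 := dε x hx
    have d2 := dp x hx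
    have d3 := du x hx μ
    have d4 := du x hx ν
    have d5 := dτ x hx μ ν
    rw [pder_sub (by fun_prop) d5, pder_add (by fun_prop) (by fun_prop),
      pder_mul (by fun_prop) d4, pder_mul (by fun_prop) d3, pder_mul (by fun_prop) d1,
      pder_mul d2 (by fun_prop), pder_add (by fun_prop) (by fun_prop),
      pder_mul (by fun_prop) d4, pder_mul (by fun_prop) d3, pder_mul d1 d3,
      pder_const, pder_const, hginv μ ν]
    ring
  have hP : ∀ l, (∑ μ, ((Matrix.of g)⁻¹ l μ + (c ^ 2)⁻¹ * u x l * u x μ) * pder prs μ x)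
      = (∑ μ, (Matrix.of g)⁻¹ l μ * pder prs μ x)
        + (c ^ 2)⁻¹ * u x l * ∑ μ, u x μ * pder prs μ x := by
    intro l
    simp only [Finset.mul_sum, ← Finset.sum_add_distrib]
    exact Finset.sum_congr rfl fun μ _ => by ring
  simp only [hdiv, hP]
  refine forall_eq_zero_iff_of_contraction (w := fun ν => ∑ l, g ν l * u x l) hc2 ?_ ?_ ?_ ?_
  · rw [inv_inv, ← hnorm x hx]
    refine Finset.sum_congr rfl fun ν _ => ?_
    rw [Finset.sum_mul]
    exact Finset.sum_congr rfl fun l _ => by ring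
  · rw [sum_mul_sum_comm]
    refine Finset.sum_eq_zero fun m _ => ?_
    rw [← mul_zero (u x m), ← hwdu m, Finset.mul_sum]
    exact Finset.sum_congr rfl fun ν _ => by ring
  · have hinv : (Matrix.of g)⁻¹ * Matrix.of g = 1 := Matrix.nonsing_inv_mul _ hgdet
    have hraise : ∀ m, ∑ ν, (Matrix.of g)⁻¹ m ν * ∑ l, g ν l * u x l = u x m := by
      intro m
      have := congrFun (congrArg (fun M => Matrix.mulVec M (u x)) hinv) m
      simp only [← Matrix.mulVec_mulVec, Matrix.one_mulVec] at this
      exact this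
    rw [sum_mul_sum_comm]
    refine Finset.sum_congr rfl fun m _ => ?_
    rw [← hraise m, Finset.sum_mul]
    refine Finset.sum_congr rfl fun ν _ => ?_
    rw [hginv m ν]
    ring
  · rw [sum_mul_sum_comm, ← Finset.sum_neg_distrib]
    exact Finset.sum_congr rfl fun m _ => hwτ m m
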